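/- arXiv:2410.03946 — 2 statements merged into one kernel-verified Lean document; each statement's English description precedes it below -/
import Mathlib

section
/- Let v₀, v₁ ∈ ℝ∖{0} and let χ be a smooth cutoff function with parameters δ > 0, γ > 1. For q = (q₀,q₁) ∈ ℝ²∖{0} set ‖q‖_v := √(v₀²q₀² + v₁²q₁²) and g(q) := χ(‖q‖_v)/(i v₀ q₀ + v₁ q₁). For p ∈ ℝ²∖{0} define the bubble diagram B(p) := (2π)^{-2} ∫_{ℝ²} g(p+q) g(q) dq, which is an absolutely convergent integral. Then there exist constants C, ε > 0 such that for all p = (p₀,p₁) with 0 < ‖p‖ ≤ ε: |B(p) − (4π|v₀v₁|)^{-1} (i v₀ p₀ − v₁ p₁)/(i v₀ p₀ + v₁ p₁)| ≤ C‖p‖. -/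
open MeasureTheory

noncomputable section

lemma cov_map (v₀ v₁ : ℝ) (hv₀ : v₀ ≠ 0) (hv₁ : v₁ ≠ 0) :
    MeasurableEmbedding (fun q : ℝ × ℝ => (⟨v₁ * q.2, v₀ * q.1⟩ : ℂ)) ∧
    Measure.map (fun q : ℝ × ℝ => (⟨v₁ * q.2, v₀ * q.1⟩ : ℂ)) volume
      = ENNReal.ofReal |(v₀ * v₁)⁻¹| • volume := by
  let M : Matrix (Fin 2) (Fin 2) ℝ := !![0, v₁; v₀, 0]
  let T : ℝ × ℝ →ₗ[ℝ] ℝ × ℝ := Matrix.toLin (Module.Basis.finTwoProd ℝ) (Module.Basis.finTwoProd ℝ) M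
  have hT : ∀ q : ℝ × ℝ, T q = (v₁ * q.2, v₀ * q.1) := by
    intro q
    simp only [T, M, Matrix.toLin_finTwoProd_apply]
    simp
  have hdet : LinearMap.det T = -(v₀ * v₁) := by
    simp [T, M, LinearMap.det_toLin, Matrix.det_fin_two]; ring
  have hd : LinearMap.det T ≠ 0 := by rw [hdet]; simp [hv₀, hv₁]
  have hmap := Measure.map_linearMap_addHaar_eq_smul_addHaar (volume : Measure (ℝ × ℝ)) hd
  have hTe : MeasurableEmbedding T := by
    apply Continuous.measurableEmbedding T.continuous_of_finiteDimensional
    intro a b hab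
    rw [hT, hT] at hab
    simp only [Prod.mk.injEq, mul_eq_mul_left_iff, hv₀, hv₁, or_false] at hab
    exact Prod.ext hab.2 hab.1
  have hS := (Complex.volume_preserving_equiv_real_prod.symm Complex.measurableEquivRealProd)
  have hcomp : (fun q : ℝ × ℝ => (⟨v₁ * q.2, v₀ * q.1⟩ : ℂ))
      = Complex.measurableEquivRealProd.symm ∘ T := by
    funext q
    simp only [Function.comp, hT]
    rfl
  refine ⟨?_, ?_⟩
  · rw [hcomp]
    exact Complex.measurableEquivRealProd.symm.measurableEmbedding.comp hTe
  · rw [hcomp, ← Measure.map_map Complex.measurableEquivRealProd.symm.measurable hTe.measurable,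
      hmap, Measure.map_smul, hS.map_eq, hdet]
    simp

lemma psi_contDiff (χ : ℝ → ℝ) (hχ : ContDiff ℝ (⊤ : ℕ∞) χ) (a : ℝ) (ha : 0 < a)
    (h1 : ∀ x, |x| ≤ a → χ x = 1) : ContDiff ℝ 2 (fun z : ℂ => χ ‖z‖) := by
  rw [contDiff_iff_contDiffAt]
  intro z
  by_cases hz : z = 0
  · subst hz
    have : (fun z : ℂ => χ ‖z‖) =ᶠ[nhds 0] fun _ => (1:ℝ) := by
      filter_upwards [Metric.ball_mem_nhds (0:ℂ) ha] with z hz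
      apply h1
      simp at hz
      simpa using hz.le
    exact contDiffAt_const.congr_of_eventuallyEq this
  · exact ((contDiff_infty.1 hχ 2).contDiffAt).comp z (contDiffAt_norm ℝ hz)

lemma psi_compact (χ : ℝ → ℝ) (δ : ℝ) (h0 : ∀ x, δ ≤ |x| → χ x = 0) :
    HasCompactSupport (fun z : ℂ => χ ‖z‖) := by
  apply HasCompactSupport.of_support_subset_isCompact (isCompact_closedBall (0:ℂ) δ)
  intro z hz
  by_contra h
  apply hz
  apply h0
  simp at h
  simpa using h.le

lemma psi_taylor (f : ℂ → ℝ) (hf : ContDiff ℝ 2 f) (hc : HasCompactSupport f) :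
    ∃ K : ℝ, 0 ≤ K ∧ ∀ z w, ‖f (z + w) - f z - fderiv ℝ f z w‖ ≤ K * ‖w‖ ^ 2 := by
  obtain ⟨K, hK⟩ := ContDiff.lipschitzWith_of_hasCompactSupport (hc.fderiv ℝ)
    (hf.fderiv_right (m := 1) (by norm_num)) one_ne_zero
  refine ⟨K, K.2, fun z w => ?_⟩
  have := Convex.norm_image_sub_le_of_norm_fderiv_le' (𝕜 := ℝ) (f := f) (C := K * ‖w‖)
    (s := Metric.closedBall z ‖w‖) (x := z) (y := z + w) (φ := fderiv ℝ f z)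
    (fun x _ => hf.differentiable (by norm_num) x) (fun x hx => ?_) (convex_closedBall _ _)
    (by simp) (by simp)
  · simpa [pow_two, mul_assoc] using this
  · refine (hK.norm_sub_le x z).trans ?_
    gcongr
    simpa [dist_eq_norm] using hx

lemma psi_fderiv (χ : ℝ → ℝ) (hχ : ContDiff ℝ (⊤ : ℕ∞) χ) (z w : ℂ) (hz : z ≠ 0) :
    fderiv ℝ (fun z : ℂ => χ ‖z‖) z w = deriv χ ‖z‖ * ((z.re * w.re + z.im * w.im) / ‖z‖) := by
  have h1 : HasFDerivAt (fun z : ℂ => Real.sqrt (‖z‖ ^ 2)) _ z :=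
    (hasStrictFDerivAt_norm_sq z).hasFDerivAt.sqrt (by simpa using hz)
  have h2 : (fun z : ℂ => Real.sqrt (‖z‖ ^ 2)) = fun z => ‖z‖ := by
    funext z; simp
  rw [h2] at h1
  have h3 : HasDerivAt χ (deriv χ ‖z‖) ‖z‖ :=
    (hχ.differentiable (by simp) _).hasDerivAt
  have h4 := (h3.comp_hasFDerivAt z h1).fderiv
  have h5 : (χ ∘ fun z : ℂ => ‖z‖) = fun z : ℂ => χ ‖z‖ := rfl
  rw [h5] at h4
  rw [h4]
  have : ‖z‖ ≠ 0 := by simpa using hz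
  simp [Complex.inner]
  field_simp
  ring_nf
  tauto

lemma psi_div_integrable (χ : ℝ → ℝ) (hχ : Continuous χ) (δ : ℝ)
    (h0 : ∀ x, δ ≤ |x| → χ x = 0) :
    Integrable (fun z : ℂ => ((χ ‖z‖ : ℝ) : ℂ) / z) := by
  have h : Integrable (fun z : ℂ => (fun r : ℝ => χ r / r) ‖z‖) := by
    refine (integrable_fun_norm_addHaar volume (f := fun r : ℝ => χ r / r)).2 ?_
    have : IntegrableOn χ (Set.Ioi 0) := by
      apply Integrable.integrableOn
      apply hχ.integrable_of_hasCompactSupport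
      apply HasCompactSupport.of_support_subset_isCompact (isCompact_closedBall (0:ℝ) δ)
      intro z hz
      by_contra h
      apply hz
      apply h0
      simp at h
      simpa using h.le
    refine this.congr_fun (fun r hr => ?_) measurableSet_Ioi
    have : r ≠ 0 := ne_of_gt hr
    simp [Complex.finrank_real_complex]
    field_simp
  refine h.mono ?_ ?_
  · apply Measurable.aestronglyMeasurable
    have := hχ.measurable
    fun_prop
  · filter_upwards with z
    simp

lemma chi_integral (χ : ℝ → ℝ) (hχ : ContDiff ℝ (⊤ : ℕ∞) χ) (δ : ℝ)
    (h0 : ∀ x, δ ≤ |x| → χ x = 0) (h1 : χ 0 = 1) :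
    ∫ r in Set.Ioi (0:ℝ), deriv χ r * χ r = -1 / 2 := by
  have hc : HasCompactSupport (fun r => χ r ^ 2 / 2) := by
    apply HasCompactSupport.of_support_subset_isCompact (isCompact_closedBall (0:ℝ) δ)
    intro z hz
    by_contra h
    apply hz
    simp at h
    simp [h0 z (by simpa using h.le)]
  have := HasCompactSupport.integral_Ioi_deriv_eq (f := fun r => χ r ^ 2 / 2)
    (by have : ContDiff ℝ 1 χ := hχ.of_le (by exact_mod_cast le_top)
        fun_prop) hc 0
  rw [h1] at this
  rw [neg_div, ← one_pow 2, ← this]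
  congr 1
  funext r
  have h3 : HasDerivAt χ (deriv χ r) r :=
    (hχ.differentiable (by simp) _).hasDerivAt
  have h6 : HasDerivAt (fun r => χ r ^ 2 / 2) _ r := (h3.pow 2).div_const 2
  rw [h6.deriv]
  simp
  ring

lemma ang_integral (w : ℂ) :
    ∫ θ in Set.Ioo (-Real.pi) Real.pi,
      (((Real.cos θ * w.re + Real.sin θ * w.im : ℝ) : ℂ) * ((Real.cos θ : ℂ) - Real.sin θ * Complex.I))
      = Real.pi * (starRingEnd ℂ) w := by
  rw [← integral_Ioc_eq_integral_Ioo, ← intervalIntegral.integral_of_le (by linarith [Real.pi_pos])]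
  have h : ∀ θ : ℝ, (((Real.cos θ * w.re + Real.sin θ * w.im : ℝ) : ℂ) * ((Real.cos θ : ℂ) - Real.sin θ * Complex.I))
      = ((Real.cos θ ^ 2 : ℝ) : ℂ) * w.re + ((Real.sin θ ^ 2 : ℝ) : ℂ) * (- w.im * Complex.I)
        + ((Real.sin θ * Real.cos θ : ℝ) : ℂ) * (w.im - w.re * Complex.I) := by
    intro θ; push_cast; ring
  simp_rw [h]
  rw [intervalIntegral.integral_add, intervalIntegral.integral_add]
  · simp only [intervalIntegral.integral_mul_const, intervalIntegral.integral_ofReal,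
      integral_cos_sq, integral_sin_sq, integral_sin_mul_cos₁]
    apply Complex.ext <;> simp
  all_goals
    apply Continuous.intervalIntegrable
    fun_prop

lemma lin_integral (χ : ℝ → ℝ) (hχ : ContDiff ℝ (⊤ : ℕ∞) χ) (δ : ℝ)
    (h0 : ∀ x, δ ≤ |x| → χ x = 0) (h1 : χ 0 = 1) (w : ℂ) :
    ∫ z : ℂ, ((fderiv ℝ (fun z : ℂ => χ ‖z‖) z w : ℝ) : ℂ) * (((χ ‖z‖ : ℝ) : ℂ) / z)
      = - (Real.pi / 2) * (starRingEnd ℂ) w := by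
  rw [← Complex.integral_comp_polarCoord_symm, polarCoord_target]
  have : ∀ p ∈ Set.Ioi (0:ℝ) ×ˢ Set.Ioo (-Real.pi) Real.pi,
      p.1 • (((fderiv ℝ (fun z : ℂ => χ ‖z‖) (Complex.polarCoord.symm p) w : ℝ) : ℂ) *
        (((χ ‖Complex.polarCoord.symm p‖ : ℝ) : ℂ) / (Complex.polarCoord.symm p)))
      = ((deriv χ p.1 * χ p.1 : ℝ) : ℂ) * (((Real.cos p.2 * w.re + Real.sin p.2 * w.im : ℝ) : ℂ)
        * ((Real.cos p.2 : ℂ) - Real.sin p.2 * Complex.I)) := by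
    rintro ⟨r, θ⟩ ⟨hr, -⟩
    have hr : 0 < r := hr
    have hn : ‖Complex.polarCoord.symm (r, θ)‖ = r := by
      rw [Complex.norm_polarCoord_symm, abs_of_pos hr]
    have hz : Complex.polarCoord.symm (r, θ) ≠ 0 := by
      rw [← norm_ne_zero_iff, hn]; exact hr.ne'
    rw [psi_fderiv χ hχ _ _ hz, hn]
    have hre : (Complex.polarCoord.symm (r, θ)).re = r * Real.cos θ := by
      rw [Complex.polarCoord_symm_apply]; simp [-Complex.ofReal_cos, -Complex.ofReal_sin]
    have him : (Complex.polarCoord.symm (r, θ)).im = r * Real.sin θ := by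
      rw [Complex.polarCoord_symm_apply]; simp [-Complex.ofReal_cos, -Complex.ofReal_sin]
    rw [hre, him, Complex.polarCoord_symm_apply]
    rw [Complex.polarCoord_symm_apply] at hz
    have hrc : (r:ℂ) ≠ 0 := by exact_mod_cast hr.ne'
    have hu : ((Real.cos θ : ℂ) + Real.sin θ * Complex.I) ≠ 0 := right_ne_zero_of_mul hz
    have hinv : ((Real.cos θ : ℂ) - Real.sin θ * Complex.I) = ((Real.cos θ : ℂ) + Real.sin θ * Complex.I)⁻¹ := by
      apply eq_inv_of_mul_eq_one_left
      have : (Real.cos θ : ℂ)^2 + (Real.sin θ : ℂ)^2 = 1 := by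
        exact_mod_cast Real.cos_sq_add_sin_sq θ
      linear_combination this - (Real.sin θ : ℂ)^2 * Complex.I_sq
    simp only [hinv, Complex.real_smul]
    push_cast at hu ⊢
    field_simp
  rw [setIntegral_congr_fun (measurableSet_Ioi.prod measurableSet_Ioo) this]
  have := setIntegral_prod_mul (μ := (volume : Measure ℝ)) (ν := (volume : Measure ℝ)) (L := ℂ)
    (fun r : ℝ => ((deriv χ r * χ r : ℝ) : ℂ))
    (fun θ : ℝ => ((Real.cos θ * w.re + Real.sin θ * w.im : ℝ) : ℂ)
        * ((Real.cos θ : ℂ) - Real.sin θ * Complex.I)) (Set.Ioi 0) (Set.Ioo (-Real.pi) Real.pi)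
  rw [← Measure.volume_eq_prod] at this
  have h7 : ∫ r in Set.Ioi (0:ℝ), ((deriv χ r * χ r : ℝ) : ℂ) = ((-1 / 2 : ℝ) : ℂ) := by
    rw [← chi_integral χ hχ δ h0 h1]
    exact integral_ofReal
  rw [this, ang_integral, h7]
  push_cast
  ring

/-- the bubble in complex coordinates -/
lemma bubble (χ : ℝ → ℝ) (hχ : ContDiff ℝ (⊤ : ℕ∞) χ) (δ a : ℝ) (ha : 0 < a)
    (h01 : ∀ x, 0 ≤ χ x ∧ χ x ≤ 1)
    (h1 : ∀ x, |x| ≤ a → χ x = 1) (h0 : ∀ x, δ ≤ |x| → χ x = 0) :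
    ∃ K : ℝ, 0 ≤ K ∧ ∀ w : ℂ, w ≠ 0 →
      Integrable (fun z : ℂ => (((χ ‖w + z‖ : ℝ) : ℂ) / (w + z)) * (((χ ‖z‖ : ℝ) : ℂ) / z)) ∧
      ‖(∫ z : ℂ, (((χ ‖w + z‖ : ℝ) : ℂ) / (w + z)) * (((χ ‖z‖ : ℝ) : ℂ) / z))
        + Real.pi * ((starRingEnd ℂ) w / w)‖ ≤ K * ‖w‖ := by
  have hcd := psi_contDiff χ hχ a ha h1
  have hcs := psi_compact χ δ h0
  obtain ⟨K, hK0, hK⟩ := psi_taylor _ hcd hcs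
  have hL := psi_div_integrable χ hχ.continuous δ h0
  have hχc := hχ.continuous
  have hone : χ 0 = 1 := h1 0 (by simpa using ha.le)
  have hb : ∀ x, ‖((χ x : ℝ) : ℂ)‖ ≤ 1 := by
    intro x
    rw [Complex.norm_real, Real.norm_of_nonneg (h01 x).1]; exact (h01 x).2
  have hG : ∀ w : ℂ, Integrable (fun z : ℂ => ((χ ‖w + z‖ : ℝ) : ℂ) * (((χ ‖z‖ : ℝ) : ℂ) / z)) := by
    intro w
    refine hL.bdd_mul (c := 1) ?_ (Filter.Eventually.of_forall fun z => hb _)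
    exact Continuous.aestronglyMeasurable (by fun_prop)
  refine ⟨2 * (K * ∫ z : ℂ, ‖((χ ‖z‖ : ℝ) : ℂ) / z‖), by positivity, fun w hw => ?_⟩
  have hG2 : Integrable (fun z : ℂ => ((χ ‖z‖ : ℝ) : ℂ) * (((χ ‖w + z‖ : ℝ) : ℂ) / (w + z))) := by
    refine (hL.comp_add_left w).bdd_mul (c := 1) ?_ (Filter.Eventually.of_forall fun z => hb _)
    exact Continuous.aestronglyMeasurable (by fun_prop)
  have hae : (fun z : ℂ => (((χ ‖w + z‖ : ℝ) : ℂ) / (w + z)) * (((χ ‖z‖ : ℝ) : ℂ) / z))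
      =ᵐ[volume] fun z : ℂ => w⁻¹ * ((((χ ‖w + z‖ : ℝ) : ℂ) * (((χ ‖z‖ : ℝ) : ℂ) / z)) -
        ((χ ‖z‖ : ℝ) : ℂ) * (((χ ‖w + z‖ : ℝ) : ℂ) / (w + z))) := by
    have e1 : ∀ᵐ z : ℂ, z ≠ 0 := Measure.ae_ne volume 0
    have e2 : ∀ᵐ z : ℂ, z ≠ -w := Measure.ae_ne volume (-w)
    filter_upwards [e1, e2] with z h1 h2
    have h3 : w + z ≠ 0 := by
      intro h; apply h2; linear_combination h
    field_simp
    ring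
  have hsub : ∫ z : ℂ, ((χ ‖z‖ : ℝ) : ℂ) * (((χ ‖w + z‖ : ℝ) : ℂ) / (w + z))
      = - ∫ z : ℂ, ((χ ‖w + z‖ : ℝ) : ℂ) * (((χ ‖z‖ : ℝ) : ℂ) / z) := by
    rw [← integral_neg_eq_self, ← integral_neg,
      ← integral_add_left_eq_self (μ := volume) _ w]
    congr 1
    funext z
    have : w + -(w + z) = -z := by ring
    rw [this, norm_neg, norm_neg, div_neg, mul_neg]
  have hzero : ∫ z : ℂ, ((χ ‖z‖ : ℝ) : ℂ) * (((χ ‖z‖ : ℝ) : ℂ) / z) = 0 := by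
    have h := integral_neg_eq_self (fun z : ℂ => ((χ ‖z‖ : ℝ) : ℂ) * (((χ ‖z‖ : ℝ) : ℂ) / z)) volume
    simp only [norm_neg, div_neg, mul_neg, integral_neg] at h
    have h2 : (2:ℂ) * ∫ z : ℂ, ((χ ‖z‖ : ℝ) : ℂ) * (((χ ‖z‖ : ℝ) : ℂ) / z) = 0 := by
      linear_combination -h
    simpa using h2
  have hlin := lin_integral χ hχ δ h0 hone w
  have hGz : Integrable (fun z : ℂ => ((χ ‖z‖ : ℝ) : ℂ) * (((χ ‖z‖ : ℝ) : ℂ) / z)) := by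
    simpa using hG 0
  have hDi : Integrable (fun z : ℂ => ((fderiv ℝ (fun z : ℂ => χ ‖z‖) z w : ℝ) : ℂ) * (((χ ‖z‖ : ℝ) : ℂ) / z)) := by
    have hcf : Continuous (fderiv ℝ (fun z : ℂ => χ ‖z‖)) := hcd.continuous_fderiv (by norm_num)
    obtain ⟨M, hM⟩ := (hcs.fderiv ℝ).exists_bound_of_continuous hcf
    refine hL.bdd_mul (c := M * ‖w‖) ?_ (Filter.Eventually.of_forall fun z => ?_)
    · exact Continuous.aestronglyMeasurable (by fun_prop)
    · rw [Complex.norm_real]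
      exact (ContinuousLinearMap.le_opNorm _ _).trans (by gcongr; exact hM z)
  have hGw : ‖(∫ z : ℂ, ((χ ‖w + z‖ : ℝ) : ℂ) * (((χ ‖z‖ : ℝ) : ℂ) / z))
      + (Real.pi / 2) * (starRingEnd ℂ) w‖ ≤ K * ‖w‖ ^ 2 * ∫ z : ℂ, ‖((χ ‖z‖ : ℝ) : ℂ) / z‖ := by
    have e : (∫ z : ℂ, ((χ ‖w + z‖ : ℝ) : ℂ) * (((χ ‖z‖ : ℝ) : ℂ) / z))
      + (Real.pi / 2) * (starRingEnd ℂ) w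
      = ∫ z : ℂ, ((χ ‖w + z‖ - χ ‖z‖ - fderiv ℝ (fun z : ℂ => χ ‖z‖) z w : ℝ) : ℂ)
          * (((χ ‖z‖ : ℝ) : ℂ) / z) := by
      simp only [Complex.ofReal_sub, sub_mul]
      have hs : Integrable (fun z : ℂ => ((χ ‖w + z‖ : ℝ) : ℂ) * (((χ ‖z‖ : ℝ) : ℂ) / z) -
          ((χ ‖z‖ : ℝ) : ℂ) * (((χ ‖z‖ : ℝ) : ℂ) / z)) := (hG w).sub hGz
      rw [integral_sub hs hDi, integral_sub (hG w) hGz, hzero, hlin]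
      ring
    rw [e, ← integral_const_mul]
    refine norm_integral_le_of_norm_le (hL.norm.const_mul _) (Filter.Eventually.of_forall fun z => ?_)
    rw [norm_mul, Complex.norm_real]
    gcongr
    rw [add_comm w z]
    exact hK z w
  refine ⟨(((hG w).sub hG2).const_mul _).congr hae.symm, ?_⟩
  rw [integral_congr_ae hae, integral_const_mul, integral_sub (hG w) hG2, hsub]
  have e : w⁻¹ * ((∫ z : ℂ, ((χ ‖w + z‖ : ℝ) : ℂ) * (((χ ‖z‖ : ℝ) : ℂ) / z))
      - - ∫ z : ℂ, ((χ ‖w + z‖ : ℝ) : ℂ) * (((χ ‖z‖ : ℝ) : ℂ) / z))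
        + Real.pi * ((starRingEnd ℂ) w / w)
      = 2 * w⁻¹ * ((∫ z : ℂ, ((χ ‖w + z‖ : ℝ) : ℂ) * (((χ ‖z‖ : ℝ) : ℂ) / z))
      + (Real.pi / 2) * (starRingEnd ℂ) w) := by ring
  rw [e, norm_mul, norm_mul, norm_inv]
  have hw' : 0 < ‖w‖ := norm_pos_iff.2 hw
  calc _ ≤ ‖(2:ℂ)‖ * ‖w‖⁻¹ * (K * ‖w‖ ^ 2 * ∫ z : ℂ, ‖((χ ‖z‖ : ℝ) : ℂ) / z‖) := by gcongr
    _ = _ := by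
      rw [Complex.norm_ofNat]; field_simp

theorem stmt6
    (v₀ v₁ δ γ : ℝ) (hv₀ : v₀ ≠ 0) (hv₁ : v₁ ≠ 0) (hδ : 0 < δ) (hγ : 1 < γ)
    (χ : ℝ → ℝ) (hχ : ContDiff ℝ (⊤ : ℕ∞) χ) (hχe : ∀ x, χ (-x) = χ x)
    (hχ01 : ∀ x, 0 ≤ χ x ∧ χ x ≤ 1)
    (hχ1 : ∀ x, |x| ≤ δ / γ → χ x = 1) (hχ0 : ∀ x, δ ≤ |x| → χ x = 0) :
    ∃ C > 0, ∃ ε > 0,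
      ∀ p : ℝ × ℝ, p ≠ 0 →
        Integrable (fun q : ℝ × ℝ =>
          ((χ (Real.sqrt (v₀ ^ 2 * (p.1 + q.1) ^ 2 + v₁ ^ 2 * (p.2 + q.2) ^ 2)) : ℂ) /
              (Complex.I * (v₀ : ℂ) * ((p.1 + q.1 : ℝ) : ℂ) +
                (v₁ : ℂ) * ((p.2 + q.2 : ℝ) : ℂ))) *
            ((χ (Real.sqrt (v₀ ^ 2 * q.1 ^ 2 + v₁ ^ 2 * q.2 ^ 2)) : ℂ) /
              (Complex.I * (v₀ : ℂ) * (q.1 : ℂ) + (v₁ : ℂ) * (q.2 : ℂ)))) ∧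
        (‖p‖ ≤ ε →
          ‖((((2 * Real.pi) ^ 2)⁻¹ : ℝ) : ℂ) *
              (∫ q : ℝ × ℝ,
                ((χ (Real.sqrt (v₀ ^ 2 * (p.1 + q.1) ^ 2 + v₁ ^ 2 * (p.2 + q.2) ^ 2)) : ℂ) /
                    (Complex.I * (v₀ : ℂ) * ((p.1 + q.1 : ℝ) : ℂ) +
                      (v₁ : ℂ) * ((p.2 + q.2 : ℝ) : ℂ))) *
                  ((χ (Real.sqrt (v₀ ^ 2 * q.1 ^ 2 + v₁ ^ 2 * q.2 ^ 2)) : ℂ) /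
                    (Complex.I * (v₀ : ℂ) * (q.1 : ℂ) + (v₁ : ℂ) * (q.2 : ℂ)))) -
            (((4 * Real.pi * |v₀ * v₁|)⁻¹ : ℝ) : ℂ) *
              ((Complex.I * (v₀ : ℂ) * (p.1 : ℂ) - (v₁ : ℂ) * (p.2 : ℂ)) /
                (Complex.I * (v₀ : ℂ) * (p.1 : ℂ) + (v₁ : ℂ) * (p.2 : ℂ)))‖ ≤
          C * ‖p‖) := by
  obtain ⟨K, hK0, hK⟩ := bubble χ hχ δ (δ / γ) (by positivity) hχ01 hχ1 hχ0
  obtain ⟨hemb, hmap⟩ := cov_map v₀ v₁ hv₀ hv₁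
  let Z : ℝ × ℝ → ℂ := fun q => ⟨v₁ * q.2, v₀ * q.1⟩
  have hZ : ∀ q : ℝ × ℝ, Complex.I * (v₀ : ℂ) * (q.1 : ℂ) + (v₁ : ℂ) * (q.2 : ℂ) = Z q := by
    intro q; apply Complex.ext <;> simp [Z]
  have hZn : ∀ q : ℝ × ℝ, Real.sqrt (v₀ ^ 2 * q.1 ^ 2 + v₁ ^ 2 * q.2 ^ 2) = ‖Z q‖ := by
    intro q
    rw [Complex.norm_def, Complex.normSq_apply]
    congr 1
    simp only [Z]
    ring
  have hZadd : ∀ p q, Z (p + q) = Z p + Z q := by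
    intro p q; apply Complex.ext <;> simp [Z] <;> ring
  set D : ℝ := |v₀ * v₁| with hD
  have hDpos : 0 < D := abs_pos.2 (mul_ne_zero hv₀ hv₁)
  have hpi := Real.pi_pos
  refine ⟨((2 * Real.pi) ^ 2)⁻¹ * D⁻¹ * (K * (|v₀| + |v₁|)) + 1, by positivity, 1, one_pos, ?_⟩
  intro p hp
  set w := Z p with hw
  have hw0 : w ≠ 0 := by
    intro h
    apply hp
    have h1 := congrArg Complex.re h
    have h2 := congrArg Complex.im h
    simp only [hw, Z, Complex.zero_re, Complex.zero_im, mul_eq_zero, hv₀, hv₁, false_or] at h1 h2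
    exact Prod.ext h2 h1
  have hwn : ‖w‖ ≤ (|v₀| + |v₁|) * ‖p‖ := by
    refine (Complex.norm_le_abs_re_add_abs_im w).trans ?_
    simp only [hw, Z, abs_mul]
    have h1 : |p.1| ≤ ‖p‖ := norm_fst_le p
    have h2 : |p.2| ≤ ‖p‖ := norm_snd_le p
    nlinarith [mul_le_mul_of_nonneg_left h1 (abs_nonneg v₀),
      mul_le_mul_of_nonneg_left h2 (abs_nonneg v₁)]
  obtain ⟨hI, hB⟩ := hK w hw0
  set h : ℂ → ℂ := fun z => (((χ ‖w + z‖ : ℝ) : ℂ) / (w + z)) * (((χ ‖z‖ : ℝ) : ℂ) / z) with hh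
  have hfun : (fun q : ℝ × ℝ =>
          ((χ (Real.sqrt (v₀ ^ 2 * (p.1 + q.1) ^ 2 + v₁ ^ 2 * (p.2 + q.2) ^ 2)) : ℂ) /
              (Complex.I * (v₀ : ℂ) * ((p.1 + q.1 : ℝ) : ℂ) +
                (v₁ : ℂ) * ((p.2 + q.2 : ℝ) : ℂ))) *
            ((χ (Real.sqrt (v₀ ^ 2 * q.1 ^ 2 + v₁ ^ 2 * q.2 ^ 2)) : ℂ) /
              (Complex.I * (v₀ : ℂ) * (q.1 : ℂ) + (v₁ : ℂ) * (q.2 : ℂ)))) = fun q => h (Z q) := by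
    funext q
    have a1 := hZ (p + q)
    have a2 := hZn (p + q)
    rw [hZadd, Prod.fst_add, Prod.snd_add] at a1 a2
    rw [a1, a2, hZ q, hZn q]
  rw [hfun]
  have hint : ∫ q, h (Z q) = ((D⁻¹ : ℝ) : ℂ) * ∫ z, h z := by
    rw [← hemb.integral_map, hmap, integral_smul_measure, ENNReal.toReal_ofReal (abs_nonneg _),
      abs_inv, Complex.real_smul]
  refine ⟨?_, fun _ => ?_⟩
  · have : Integrable h (Measure.map Z volume) := by
      rw [hmap]; exact hI.smul_measure ENNReal.ofReal_ne_top
    exact hemb.integrable_map_iff.1 this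
  · rw [hint, hZ p]
    have hnum : Complex.I * (v₀ : ℂ) * (p.1 : ℂ) - (v₁ : ℂ) * (p.2 : ℂ) = - (starRingEnd ℂ) w := by
      apply Complex.ext <;> simp [hw, Z]
    rw [hnum]
    have hDc : (D : ℂ) ≠ 0 := by exact_mod_cast hDpos.ne'
    have hpc : (Real.pi : ℂ) ≠ 0 := by exact_mod_cast hpi.ne'
    have e : ((((2 * Real.pi) ^ 2)⁻¹ : ℝ) : ℂ) * (((D⁻¹ : ℝ) : ℂ) * ∫ z, h z)
        - (((4 * Real.pi * D)⁻¹ : ℝ) : ℂ) * (- (starRingEnd ℂ) w / w)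
        = ((((2 * Real.pi) ^ 2)⁻¹ * D⁻¹ : ℝ) : ℂ) * ((∫ z, h z) + Real.pi * ((starRingEnd ℂ) w / w)) := by
      push_cast
      field_simp
      ring
    rw [e, norm_mul, Complex.norm_real, Real.norm_of_nonneg (by positivity)]
    calc _ ≤ ((2 * Real.pi) ^ 2)⁻¹ * D⁻¹ * (K * ((|v₀| + |v₁|) * ‖p‖)) := by
          gcongr
          exact hB.trans (by gcongr)
      _ ≤ _ := by nlinarith [norm_nonneg p]

end
end

section
/- Let δ > 0, γ > 1, a > 0, C₀ > 0, n̄ ∈ ℕ, v₀, v₁ ∈ ℝ∖{0}, and let χ be a smooth cutoff function with parameters δ, γ. For q = (q₀,q₁) ∈ ℝ² set ‖q‖_v := √(v₀²q₀² + v₁²q₁²). Let h ≤ 0 be an integer and f_h(q) := χ(γ^{-h}‖q‖_v) − χ(γ^{-h+1}‖q‖_v). Let r : ℝ → ℝ be n̄ times continuously differentiable with |r^{(n)}(q₁)| ≤ C₀ γ^{h(1+a−n)} for all 0 ≤ n ≤ n̄ and all q₁ with |q₁| ≤ δγ^h/|v₁|, and assume C₀γ^{ha} ≤ δγ^{-2}/2.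 Define g_h(q) := f_h(q)/(i v₀ q₀ + v₁ q₁ + r(q₁)) on the support of f_h and g_h(q) := 0 elsewhere (on the support of f_h the denominator does not vanish, since there ‖q‖_v ≥ δγ^{h−2} and |r(q₁)| ≤ δγ^{h−2}/2). Then for all n₀, n₁ ∈ ℕ with n₀+n₁ ≤ n̄ there is K_{n₀,n₁} > 0, depending only on χ, δ, γ, a, C₀, v₀, v₁, n̄ (and not on h, r or q), such that |∂_{q₀}^{n₀}∂_{q₁}^{n₁} g_h(q)| ≤ K_{n₀,n₁} γ^{-h(1+n₀+n₁)} for all q in the support of f_h. -/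
noncomputable section

/-- The mixed partial derivative `∂_{q₀}^{n₀} ∂_{q₁}^{n₁} g` of a function of two real
variables. -/
def mixedPartial (n₀ n₁ : ℕ) (g : ℝ × ℝ → ℂ) (q : ℝ × ℝ) : ℂ :=
  iteratedDeriv n₀ (fun a => iteratedDeriv n₁ (fun b => g (a, b)) q.2) q.1

lemma aux_scale (n : ℕ) (c : ℝ) (f : ℝ → ℂ) (x : ℝ) :
    iteratedDeriv n (fun t => f (c * t)) x = (c : ℂ) ^ n * iteratedDeriv n f (c * x) := by
  induction n generalizing x with
  | zero => simp
  | succ n ih =>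
    rw [iteratedDeriv_succ]
    have : iteratedDeriv n (fun t => f (c * t)) =
        fun x => (c : ℂ) ^ n * iteratedDeriv n f (c * x) := funext ih
    rw [this, deriv_const_mul_field', iteratedDeriv_succ]
    simp only
    rw [deriv_comp_mul_left c (iteratedDeriv n f) x, Complex.real_smul]
    ring

lemma aux_mixed_scale (n₀ n₁ : ℕ) (c : ℝ) (k : ℂ) (G : ℝ × ℝ → ℂ) (q : ℝ × ℝ) :
    mixedPartial n₀ n₁ (fun p => k * G (c * p.1, c * p.2)) q =
      k * (c : ℂ) ^ (n₀ + n₁) * mixedPartial n₀ n₁ G (c * q.1, c * q.2) := by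
  unfold mixedPartial
  have h1 : ∀ a : ℝ, iteratedDeriv n₁ (fun b => k * G (c * a, c * b)) q.2 =
      k * ((c : ℂ) ^ n₁ * iteratedDeriv n₁ (fun b => G (c * a, b)) (c * q.2)) := by
    intro a
    rw [iteratedDeriv_const_mul_field, aux_scale n₁ c (fun b => G (c * a, b))]
  simp only [h1]
  rw [iteratedDeriv_const_mul_field, iteratedDeriv_const_mul_field,
    aux_scale n₀ c (fun a => iteratedDeriv n₁ (fun b => G (a, b)) (c * q.2))]
  ring

lemma aux_line {E : Type*} [NormedAddCommGroup E] [NormedSpace ℝ E] (G : E → ℂ) (S : Set E)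
    (hS : IsOpen S) (N : ℕ) (hG : ContDiffOn ℝ N G S) (e : E) (he : ‖e‖ ≤ 1)
    (k : ℕ) (m : Fin k → E) (hm : ∀ i, ‖m i‖ ≤ 1) (j : ℕ) (hj : k + j ≤ N) :
    ∃ m' : Fin (k + j) → E, (∀ i, ‖m' i‖ ≤ 1) ∧ ∀ x : E, ∀ t : ℝ, x + t • e ∈ S →
      iteratedDeriv j (fun t : ℝ => iteratedFDeriv ℝ k G (x + t • e) m) t =
        iteratedFDeriv ℝ (k + j) G (x + t • e) m' := by
  induction j with
  | zero => exact ⟨m, hm, fun x t _ => by simp⟩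
  | succ j ih =>
    obtain ⟨m', hm', H⟩ := ih (by omega)
    refine ⟨Fin.cons (α := fun _ => E) e m', fun i => ?_, fun x t hx => ?_⟩
    · refine Fin.cases ?_ ?_ i
      · simpa using he
      · intro i; simpa using hm' i
    · rw [iteratedDeriv_succ]
      have hcont : Continuous fun t : ℝ => x + t • e := by fun_prop
      have hev : (iteratedDeriv j (fun t : ℝ => iteratedFDeriv ℝ k G (x + t • e) m)) =ᶠ[nhds t]
          fun t => iteratedFDeriv ℝ (k + j) G (x + t • e) m' := by
        filter_upwards [(hS.preimage hcont).mem_nhds hx] with s hs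
        exact H x s hs
      rw [hev.deriv_eq]
      have hd : DifferentiableAt ℝ (iteratedFDeriv ℝ (k + j) G) (x + t • e) :=
        (hG.contDiffAt (hS.mem_nhds hx)).differentiableAt_iteratedFDeriv
          (by exact_mod_cast (by omega : k + j < N))
      have hl : HasDerivAt (fun t : ℝ => x + t • e) e t := by
        simpa using ((hasDerivAt_id t).smul_const e).const_add x
      have h2 := hd.hasFDerivAt.comp_hasDerivAt t hl
      have h3 := ((ContinuousMultilinearMap.apply ℝ (fun _ : Fin (k + j) => E) ℂ
        m').hasFDerivAt).comp_hasDerivAt t h2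
      have h4 : HasDerivAt (fun t : ℝ => iteratedFDeriv ℝ (k + j) G (x + t • e) m')
        ((fderiv ℝ (iteratedFDeriv ℝ (k + j) G) (x + t • e) e) m') t := h3
      rw [h4.deriv]
      exact (iteratedFDeriv_succ_apply_left (𝕜 := ℝ) (f := G) (x := x + t • e)
        (n := k + j) (Fin.cons (α := fun _ => E) e m')).symm

lemma aux_mixed_le (G : ℝ × ℝ → ℂ) (S : Set (ℝ × ℝ)) (hS : IsOpen S) (n₀ n₁ : ℕ)
    (hG : ContDiffOn ℝ ((n₁ + n₀ : ℕ)) G S) (q : ℝ × ℝ) (hq : q ∈ S) :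
    ‖mixedPartial n₀ n₁ G q‖ ≤ ‖iteratedFDeriv ℝ (n₁ + n₀) G q‖ := by
  obtain ⟨m1, hm1, H1⟩ := aux_line G S hS (n₁ + n₀) hG (0, 1) (by simp [Prod.norm_def]) 0
    (fun i => i.elim0) (fun i => i.elim0) n₁ (by omega)
  have H1' : ∃ m1 : Fin n₁ → ℝ × ℝ, (∀ i, ‖m1 i‖ ≤ 1) ∧ ∀ a b : ℝ, (a, b) ∈ S →
      iteratedDeriv n₁ (fun b => G (a, b)) b = iteratedFDeriv ℝ n₁ G (a, b) m1 := by
    have := Nat.zero_add n₁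
    generalize 0 + n₁ = n at *
    subst this
    refine ⟨m1, hm1, fun a b hab => ?_⟩
    simpa using H1 (a, 0) b (by simpa using hab)
  obtain ⟨m1, hm1, H1⟩ := H1'
  obtain ⟨m2, hm2, H2⟩ := aux_line G S hS (n₁ + n₀) hG (1, 0) (by simp [Prod.norm_def]) n₁
    m1 hm1 n₀ le_rfl
  have h := H2 (0, q.2) q.1 (by simpa using hq)
  have hcont : Continuous fun a : ℝ => (a, q.2) := by fun_prop
  have hev : (fun a => iteratedDeriv n₁ (fun b => G (a, b)) q.2) =ᶠ[nhds q.1]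
      fun t : ℝ => iteratedFDeriv ℝ n₁ G ((0, q.2) + t • ((1 : ℝ), (0 : ℝ))) m1 := by
    filter_upwards [(hS.preimage hcont).mem_nhds hq] with s hs
    simpa using H1 s q.2 hs
  unfold mixedPartial
  rw [hev.iteratedDeriv_eq, h]
  simp only [Prod.smul_mk, smul_eq_mul, mul_one, mul_zero, Prod.mk_add_mk, zero_add, add_zero]
  refine (ContinuousMultilinearMap.le_opNorm _ _).trans ?_
  refine mul_le_of_le_one_right (norm_nonneg _) ?_
  exact Finset.prod_le_one (fun _ _ => norm_nonneg _) (fun i _ => hm2 i)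

/-- Uniform bound for derivatives of a composition with a graph map. -/
lemma aux_graph (Ψ : (ℝ × ℝ) × ℝ → ℂ) (W K : Set ((ℝ × ℝ) × ℝ)) (hW : IsOpen W)
    (hK : IsCompact K) (hKW : K ⊆ W) (n₀ n₁ N : ℕ) (hN : n₀ + n₁ ≤ N)
    (hΨ : ContDiffOn ℝ N Ψ W) (η : ℝ) (hη : 0 ≤ η) :
    ∃ C > 0, ∀ R : ℝ → ℝ, ContDiff ℝ N R → ∀ p : ℝ × ℝ, (p, R p.2) ∈ K →
      (∀ n ≤ N, |iteratedDeriv n R p.2| ≤ η) →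
      ‖mixedPartial n₀ n₁ (fun p => Ψ (p, R p.2)) p‖ ≤ C := by
  have hb : ∀ i : ℕ, ∃ B : ℝ, i ≤ N → ∀ w ∈ K, ‖iteratedFDerivWithin ℝ i Ψ W w‖ ≤ B := by
    intro i
    by_cases hi : i ≤ N
    · obtain ⟨B, hB⟩ := hK.exists_bound_of_continuousOn
        ((hΨ.continuousOn_iteratedFDerivWithin (m := i) (by exact_mod_cast hi)
          hW.uniqueDiffOn).mono hKW)
      exact ⟨B, fun _ => hB⟩
    · exact ⟨0, fun h => absurd h hi⟩
  choose B hB using hb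
  set C := ∑ i ∈ Finset.range (N + 1), |B i| with hCdef
  have hC0 : 0 ≤ C := Finset.sum_nonneg fun _ _ => abs_nonneg _
  have hCi : ∀ i ≤ N, ∀ w ∈ K, ‖iteratedFDerivWithin ℝ i Ψ W w‖ ≤ C := by
    intro i hi w hw
    refine (hB i hi w hw).trans ((le_abs_self _).trans ?_)
    exact Finset.single_le_sum (f := fun i => |B i|) (fun _ _ => abs_nonneg _)
      (Finset.mem_range.2 (by omega))
  refine ⟨(n₁ + n₀).factorial * C * (1 + η) ^ (n₁ + n₀) + 1, by positivity, ?_⟩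
  intro R hR p hp hRb
  have hR2 : ContDiff ℝ N (fun p : ℝ × ℝ => R p.2) := hR.comp contDiff_snd
  have hφ : ContDiff ℝ N (fun p : ℝ × ℝ => (p, R p.2)) := contDiff_id.prodMk hR2
  set S : Set (ℝ × ℝ) := (fun p : ℝ × ℝ => (p, R p.2)) ⁻¹' W with hSdef
  have hS : IsOpen S := hW.preimage hφ.continuous
  have hpS : p ∈ S := hKW hp
  have hmaps : Set.MapsTo (fun p : ℝ × ℝ => (p, R p.2)) S W := fun x hx => hx
  have hcomp : ContDiffOn ℝ N (fun p => Ψ (p, R p.2)) S := hΨ.comp hφ.contDiffOn hmaps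
  have h1 := aux_mixed_le (fun p => Ψ (p, R p.2)) S hS n₀ n₁
    (hcomp.of_le (by exact_mod_cast (by omega : n₁ + n₀ ≤ N))) p hpS
  refine h1.trans ?_
  rw [← iteratedFDerivWithin_of_isOpen _ hS hpS]
  have h2 := norm_iteratedFDerivWithin_comp_le (n := n₁ + n₀) (D := 1 + η) hΨ hφ.contDiffOn
    (by exact_mod_cast (by omega : n₁ + n₀ ≤ N)) hW.uniqueDiffOn hS.uniqueDiffOn hmaps hpS
    (fun i hi => hCi i (by omega) _ hp) ?_
  · exact h2.trans (by linarith)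
  intro i hi1 hi2
  have hiN : i ≤ N := by omega
  rw [iteratedFDerivWithin_of_isOpen _ hS hpS,
    iteratedFDeriv_prodMk (n := N) (f := fun x : ℝ × ℝ => x) contDiffAt_id hR2.contDiffAt
      (by exact_mod_cast hiN),
    ContinuousMultilinearMap.opNorm_prod]
  have hge : 1 + η ≤ (1 + η) ^ i := le_self_pow₀ (by linarith) (by omega)
  refine le_trans (max_le ?_ ?_) hge
  · obtain ⟨i, rfl⟩ : ∃ k, i = k + 1 := ⟨i - 1, by omega⟩
    rw [← norm_iteratedFDeriv_fderiv]
    have : fderiv ℝ (fun x : ℝ × ℝ => x) = fun _ => ContinuousLinearMap.id ℝ (ℝ × ℝ) := by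
      ext1 x; exact fderiv_id'
    rw [this]
    rcases i with _ | i
    · rw [norm_iteratedFDeriv_zero]
      exact ContinuousLinearMap.norm_id_le.trans (by linarith)
    · rw [iteratedFDeriv_succ_const]; simp; linarith
  · have := (ContinuousLinearMap.snd ℝ ℝ ℝ).iteratedFDeriv_comp_right hR p (i := i)
      (by exact_mod_cast hiN)
    have h3 : iteratedFDeriv ℝ i (fun p : ℝ × ℝ => R p.2) p = _ := this
    rw [h3]
    refine (ContinuousMultilinearMap.norm_compContinuousLinearMap_le _ _).trans ?_
    have h4 : ‖iteratedFDeriv ℝ i R p.2‖ ≤ η := by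
      rw [norm_iteratedFDeriv_eq_norm_iteratedDeriv]; exact hRb i hiN
    have h5 : ∏ j : Fin i, ‖ContinuousLinearMap.snd ℝ ℝ ℝ‖ ≤ 1 :=
      Finset.prod_le_one (fun _ _ => norm_nonneg _)
        (fun _ _ => ContinuousLinearMap.norm_snd_le ℝ ℝ ℝ)
    exact (mul_le_of_le_one_right (norm_nonneg _) h5).trans (h4.trans (by linarith))

lemma aux_denom (v₀ v₁ x y z : ℝ) (h : |z| < Real.sqrt (v₀ ^ 2 * x ^ 2 + v₁ ^ 2 * y ^ 2)) :
    Complex.I * (v₀ : ℂ) * (x : ℂ) + (v₁ : ℂ) * (y : ℂ) + (z : ℂ) ≠ 0 := by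
  intro h0
  have hre := congrArg Complex.re h0
  have him := congrArg Complex.im h0
  simp at hre him
  have e1 : v₀ ^ 2 * x ^ 2 = 0 := by rcases him with h | h <;> simp [h]
  have e2 : v₁ * y = - z := by linarith
  have e3 : v₀ ^ 2 * x ^ 2 + v₁ ^ 2 * y ^ 2 = z ^ 2 := by
    rw [e1, ← mul_pow, e2]; ring
  rw [e3, Real.sqrt_sq_eq_abs] at h
  exact lt_irrefl _ h

lemma aux_unit (δ γ : ℝ) (nbar : ℕ) (v₀ v₁ : ℝ)
    (hδ : 0 < δ) (hγ : 1 < γ) (hv₀ : v₀ ≠ 0) (hv₁ : v₁ ≠ 0)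
    (χ : ℝ → ℝ) (hχ : ContDiff ℝ (⊤ : ℕ∞) χ) (n₀ n₁ : ℕ) (hn : n₀ + n₁ ≤ nbar) :
    ∃ C > 0, ∀ R : ℝ → ℝ, ContDiff ℝ nbar R → ∀ p : ℝ × ℝ,
      δ / γ ^ 2 ≤ Real.sqrt (v₀ ^ 2 * p.1 ^ 2 + v₁ ^ 2 * p.2 ^ 2) →
      Real.sqrt (v₀ ^ 2 * p.1 ^ 2 + v₁ ^ 2 * p.2 ^ 2) ≤ δ →
      (∀ n ≤ nbar, |iteratedDeriv n R p.2| ≤ δ / γ ^ 2 / 2) →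
      ‖mixedPartial n₀ n₁ (fun p : ℝ × ℝ =>
          ((χ (Real.sqrt (v₀ ^ 2 * p.1 ^ 2 + v₁ ^ 2 * p.2 ^ 2)) -
            χ (γ * Real.sqrt (v₀ ^ 2 * p.1 ^ 2 + v₁ ^ 2 * p.2 ^ 2)) : ℝ) : ℂ) /
          (Complex.I * (v₀ : ℂ) * (p.1 : ℂ) + (v₁ : ℂ) * (p.2 : ℂ) + ((R p.2 : ℝ) : ℂ))) p‖
        ≤ C := by
  have hη : 0 < δ / γ ^ 2 := by positivity
  let Ψ : (ℝ × ℝ) × ℝ → ℂ := fun w =>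
    ((χ (Real.sqrt (v₀ ^ 2 * w.1.1 ^ 2 + v₁ ^ 2 * w.1.2 ^ 2)) -
      χ (γ * Real.sqrt (v₀ ^ 2 * w.1.1 ^ 2 + v₁ ^ 2 * w.1.2 ^ 2)) : ℝ) : ℂ) /
    (Complex.I * (v₀ : ℂ) * (w.1.1 : ℂ) + (v₁ : ℂ) * (w.1.2 : ℂ) + (w.2 : ℂ))
  let W : Set ((ℝ × ℝ) × ℝ) := {w | v₀ ^ 2 * w.1.1 ^ 2 + v₁ ^ 2 * w.1.2 ^ 2 ≠ 0} ∩
    {w | Complex.I * (v₀ : ℂ) * (w.1.1 : ℂ) + (v₁ : ℂ) * (w.1.2 : ℂ) + (w.2 : ℂ) ≠ 0}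
  let K : Set ((ℝ × ℝ) × ℝ) :=
    {w | δ / γ ^ 2 ≤ Real.sqrt (v₀ ^ 2 * w.1.1 ^ 2 + v₁ ^ 2 * w.1.2 ^ 2)} ∩
    {w | Real.sqrt (v₀ ^ 2 * w.1.1 ^ 2 + v₁ ^ 2 * w.1.2 ^ 2) ≤ δ} ∩
    {w | |w.2| ≤ δ / γ ^ 2 / 2}
  have hW : IsOpen W := by
    apply IsOpen.inter
    · exact isOpen_ne_fun (by fun_prop) (by fun_prop)
    · exact isOpen_ne_fun (by fun_prop) (by fun_prop)
  have hKc : IsClosed K := by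
    refine IsClosed.inter (IsClosed.inter ?_ ?_) ?_
    · exact isClosed_le (by fun_prop) (by fun_prop)
    · exact isClosed_le (by fun_prop) (by fun_prop)
    · exact isClosed_le (by fun_prop) (by fun_prop)
  have hK : IsCompact K := by
    refine IsCompact.of_isClosed_subset
      ((isCompact_Icc (a := -(δ / |v₀|)) (b := δ / |v₀|)).prod
        (isCompact_Icc (a := -(δ / |v₁|)) (b := δ / |v₁|)) |>.prod
        (isCompact_Icc (a := -(δ / γ ^ 2 / 2)) (b := δ / γ ^ 2 / 2))) hKc ?_
    rintro ⟨⟨x, y⟩, z⟩ ⟨⟨_, h2⟩, h3⟩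
    simp only [Set.mem_ofPred_eq] at h2 h3
    have hx : |v₀ * x| ≤ δ := by
      refine le_trans (Real.abs_le_sqrt ?_) h2
      nlinarith [sq_nonneg (v₁ * y)]
    have hy : |v₁ * y| ≤ δ := by
      refine le_trans (Real.abs_le_sqrt ?_) h2
      nlinarith [sq_nonneg (v₀ * x)]
    have hv0 := abs_pos.2 hv₀
    have hv1 := abs_pos.2 hv₁
    rw [abs_mul] at hx hy
    refine ⟨⟨abs_le.1 ?_, abs_le.1 ?_⟩, abs_le.1 h3⟩
    · rw [le_div_iff₀ hv0]; linarith
    · rw [le_div_iff₀ hv1]; linarith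
  have hKW : K ⊆ W := by
    rintro ⟨⟨x, y⟩, z⟩ ⟨⟨h1, h2⟩, h3⟩
    simp only [Set.mem_ofPred_eq] at h1 h2 h3
    refine ⟨?_, ?_⟩
    · intro h0
      simp only at h0
      rw [h0] at h1
      simp only [Real.sqrt_zero] at h1
      linarith
    · exact aux_denom v₀ v₁ x y z (by linarith)
  have hΨ : ContDiffOn ℝ nbar Ψ W := by
    have hχ' : ContDiff ℝ nbar χ := hχ.of_le (by exact_mod_cast le_top)
    have hs : ContDiffOn ℝ nbar
        (fun w : (ℝ × ℝ) × ℝ => Real.sqrt (v₀ ^ 2 * w.1.1 ^ 2 + v₁ ^ 2 * w.1.2 ^ 2)) W :=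
      ContDiffOn.sqrt (by fun_prop) (fun w hw => hw.1)
    have hof : ∀ {f : (ℝ × ℝ) × ℝ → ℝ}, ContDiffOn ℝ nbar f W →
        ContDiffOn ℝ nbar (fun w => (f w : ℂ)) W := fun hf =>
      Complex.ofRealCLM.contDiff.comp_contDiffOn hf
    simp only [Ψ, div_eq_mul_inv]
    refine ContDiffOn.mul ?_ (ContDiffOn.inv ?_ (fun w hw => hw.2))
    · exact hof ((hχ'.comp_contDiffOn hs).sub (hχ'.comp_contDiffOn (contDiffOn_const.mul hs)))
    · refine ((contDiffOn_const.mul (hof ?_)).add (contDiffOn_const.mul (hof ?_))).add (hof ?_)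
      · fun_prop
      · fun_prop
      · fun_prop
  obtain ⟨C, hC, H⟩ := aux_graph Ψ W K hW hK hKW n₀ n₁ nbar hn hΨ (δ / γ ^ 2 / 2) (by positivity)
  refine ⟨C, hC, fun R hR p h1 h2 h3 => ?_⟩
  exact H R hR p ⟨⟨h1, h2⟩, by simpa using h3 0 (Nat.zero_le _)⟩ h3

/-- Dimensional bounds on the momentum derivatives of the single-scale
propagator at scale `h ≤ 0`, uniformly in the scale and in the dispersion correction `r`. -/
theorem stmt13
    (δ γ a C₀ : ℝ) (nbar : ℕ) (v₀ v₁ : ℝ)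
    (hδ : 0 < δ) (hγ : 1 < γ) (ha : 0 < a) (hC₀ : 0 < C₀) (hv₀ : v₀ ≠ 0) (hv₁ : v₁ ≠ 0)
    (χ : ℝ → ℝ) (hχ : ContDiff ℝ (⊤ : ℕ∞) χ) (hχe : ∀ x, χ (-x) = χ x)
    (hχ01 : ∀ x, 0 ≤ χ x ∧ χ x ≤ 1)
    (hχ1 : ∀ x, |x| ≤ δ / γ → χ x = 1) (hχ0 : ∀ x, δ ≤ |x| → χ x = 0) :
    ∀ n₀ n₁ : ℕ, n₀ + n₁ ≤ nbar →
      ∃ K > 0, ∀ h : ℤ, h ≤ 0 →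
        ∀ r : ℝ → ℝ, ContDiff ℝ (nbar : ℕ∞) r →
          (∀ n : ℕ, n ≤ nbar → ∀ q₁ : ℝ, |q₁| ≤ δ * γ ^ ((h : ℝ)) / |v₁| →
            |iteratedDeriv n r q₁| ≤ C₀ * γ ^ ((h : ℝ) * (1 + a - (n : ℝ)))) →
          C₀ * γ ^ ((h : ℝ) * a) ≤ δ * γ ^ ((-2 : ℝ)) / 2 →
          ∀ q : ℝ × ℝ,
            χ (γ ^ (-(h : ℝ)) * Real.sqrt (v₀ ^ 2 * q.1 ^ 2 + v₁ ^ 2 * q.2 ^ 2)) -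
                χ (γ ^ (-(h : ℝ) + 1) * Real.sqrt (v₀ ^ 2 * q.1 ^ 2 + v₁ ^ 2 * q.2 ^ 2)) ≠ 0 →
            (Complex.I * (v₀ : ℂ) * (q.1 : ℂ) + (v₁ : ℂ) * (q.2 : ℂ) + ((r q.2 : ℝ) : ℂ) ≠ 0) ∧
            ‖mixedPartial n₀ n₁
                (fun p : ℝ × ℝ =>
                  ((χ (γ ^ (-(h : ℝ)) * Real.sqrt (v₀ ^ 2 * p.1 ^ 2 + v₁ ^ 2 * p.2 ^ 2)) -
                      χ (γ ^ (-(h : ℝ) + 1) *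
                        Real.sqrt (v₀ ^ 2 * p.1 ^ 2 + v₁ ^ 2 * p.2 ^ 2)) : ℝ) : ℂ) /
                    (Complex.I * (v₀ : ℂ) * (p.1 : ℂ) + (v₁ : ℂ) * (p.2 : ℂ) +
                      ((r p.2 : ℝ) : ℂ)))
                q‖ ≤
              K * γ ^ (-(h : ℝ) * (1 + (n₀ : ℝ) + (n₁ : ℝ))) := by
  intro n₀ n₁ hn
  obtain ⟨C, hC, H⟩ := aux_unit δ γ nbar v₀ v₁ hδ hγ hv₀ hv₁ χ hχ n₀ n₁ hn
  refine ⟨C, hC, ?_⟩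
  intro h hh r hr hrb hsmall q hq
  have hγ0 : 0 < γ := by linarith
  have hγ2 : γ ^ (-2 : ℝ) = (γ ^ 2)⁻¹ := by
    rw [Real.rpow_neg hγ0.le]; norm_cast
  set c : ℝ := γ ^ (-(h : ℝ)) with hc
  have hc0 : 0 < c := Real.rpow_pos_of_pos hγ0 _
  have hch : γ ^ (h : ℝ) = c⁻¹ := by rw [hc, Real.rpow_neg hγ0.le, inv_inv]
  have hc1 : γ ^ (-(h : ℝ) + 1) = γ * c := by
    rw [Real.rpow_add hγ0, Real.rpow_one, mul_comm]
  have hsq : ∀ x y : ℝ, Real.sqrt (v₀ ^ 2 * (c * x) ^ 2 + v₁ ^ 2 * (c * y) ^ 2) =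
      c * Real.sqrt (v₀ ^ 2 * x ^ 2 + v₁ ^ 2 * y ^ 2) := by
    intro x y
    rw [show v₀ ^ 2 * (c * x) ^ 2 + v₁ ^ 2 * (c * y) ^ 2 =
      c ^ 2 * (v₀ ^ 2 * x ^ 2 + v₁ ^ 2 * y ^ 2) by ring,
      Real.sqrt_mul (sq_nonneg c), Real.sqrt_sq hc0.le]
  set R : ℝ → ℝ := fun x => c * r (c⁻¹ * x) with hRdef
  have hr' : ContDiff ℝ (nbar : WithTop ℕ∞) r := by exact_mod_cast hr
  have hR : ContDiff ℝ (nbar : WithTop ℕ∞) R :=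
    contDiff_const.mul (hr'.comp (contDiff_const.mul contDiff_id))
  set ρ : ℝ := Real.sqrt (v₀ ^ 2 * (c * q.1) ^ 2 + v₁ ^ 2 * (c * q.2) ^ 2) with hρ
  have hρ0 : 0 ≤ ρ := Real.sqrt_nonneg _
  have hq' : χ ρ - χ (γ * ρ) ≠ 0 := by
    rw [hρ, hsq, ← mul_assoc, ← hc1]; exact hq
  have hub : ρ ≤ δ := by
    by_contra hlt
    push Not at hlt
    apply hq'
    rw [hχ0 ρ (by rw [abs_of_nonneg hρ0]; exact hlt.le),
      hχ0 (γ * ρ) (by rw [abs_of_nonneg (by positivity)]; nlinarith), sub_self]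
  have hlb : δ / γ ^ 2 ≤ ρ := by
    by_contra hlt
    push Not at hlt
    apply hq'
    rw [lt_div_iff₀ (by positivity)] at hlt
    have e2 : γ * ρ ≤ δ / γ := by
      rw [le_div_iff₀ hγ0]; nlinarith
    have e1 : ρ ≤ δ / γ := le_trans (by nlinarith) e2
    rw [hχ1 ρ (by rwa [abs_of_nonneg hρ0]),
      hχ1 (γ * ρ) (by rwa [abs_of_nonneg (by positivity)]), sub_self]
  have hq2 : |q.2| ≤ δ * γ ^ (h : ℝ) / |v₁| := by
    have hv1 := abs_pos.2 hv₁
    have : |v₁ * (c * q.2)| ≤ δ := by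
      refine le_trans (Real.abs_le_sqrt ?_) hub
      nlinarith [sq_nonneg (v₀ * (c * q.1))]
    rw [abs_mul, abs_mul, abs_of_pos hc0] at this
    rw [hch, le_div_iff₀ hv1, ← div_eq_mul_inv, le_div_iff₀ hc0]
    linarith
  have hRb : ∀ n ≤ nbar, |iteratedDeriv n R (c * q.2)| ≤ δ / γ ^ 2 / 2 := by
    intro n hnn
    have hrn : ContDiff ℝ (n : WithTop ℕ∞) r := hr'.of_le (by exact_mod_cast hnn)
    have e1 : iteratedDeriv n R (c * q.2) = c * ((c⁻¹) ^ n * iteratedDeriv n r q.2) := by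
      rw [hRdef, iteratedDeriv_const_mul_field, iteratedDeriv_comp_const_mul hrn]
      simp only
      rw [inv_mul_cancel_left₀ hc0.ne']
    have e2 : c * ((c⁻¹) ^ n * (C₀ * γ ^ ((h : ℝ) * (1 + a - (n : ℝ))))) =
        C₀ * γ ^ ((h : ℝ) * a) := by
      have e3 : c⁻¹ ^ n = γ ^ ((h : ℝ) * n) := by
        rw [← hch, ← Real.rpow_natCast, ← Real.rpow_mul hγ0.le]
      have e4 : c * (γ ^ ((h : ℝ) * n) * γ ^ ((h : ℝ) * (1 + a - (n : ℝ)))) =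
          γ ^ ((h : ℝ) * a) := by
        rw [hc, ← Real.rpow_add hγ0, ← Real.rpow_add hγ0]
        congr 1; ring
      rw [e3, ← e4]; ring
    rw [e1, abs_mul, abs_mul, abs_of_pos hc0, abs_of_pos (by positivity : 0 < c⁻¹ ^ n)]
    calc c * (c⁻¹ ^ n * |iteratedDeriv n r q.2|)
        ≤ c * ((c⁻¹) ^ n * (C₀ * γ ^ ((h : ℝ) * (1 + a - (n : ℝ))))) := by
          gcongr; exact hrb n hnn q.2 hq2
      _ = C₀ * γ ^ ((h : ℝ) * a) := e2
      _ ≤ δ * γ ^ (-2 : ℝ) / 2 := hsmall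
      _ = δ / γ ^ 2 / 2 := by rw [hγ2, ← div_eq_mul_inv]
  have hcC : (c : ℂ) ≠ 0 := by exact_mod_cast hc0.ne'
  have hRc : ∀ x : ℝ, R (c * x) = c * r x := by
    intro x; simp only [hRdef]; rw [inv_mul_cancel_left₀ hc0.ne']
  have hden : ∀ x y : ℝ, Complex.I * (v₀ : ℂ) * ((c * x : ℝ) : ℂ) + (v₁ : ℂ) * ((c * y : ℝ) : ℂ) +
      ((R (c * y) : ℝ) : ℂ) =
      (c : ℂ) * (Complex.I * (v₀ : ℂ) * (x : ℂ) + (v₁ : ℂ) * (y : ℂ) + ((r y : ℝ) : ℂ)) := by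
    intro x y; rw [hRc]; push_cast; ring
  refine ⟨?_, ?_⟩
  · have hη : 0 < δ / γ ^ 2 := by positivity
    have h0 : |R (c * q.2)| ≤ δ / γ ^ 2 / 2 := by simpa using hRb 0 (Nat.zero_le _)
    have := aux_denom v₀ v₁ (c * q.1) (c * q.2) (R (c * q.2))
      (lt_of_lt_of_le (by linarith) hlb)
    rw [hden] at this
    exact right_ne_zero_of_mul this
  · have hmain := H R hR (c * q.1, c * q.2) hlb hub hRb
    set G : ℝ × ℝ → ℂ := fun p : ℝ × ℝ =>
          ((χ (Real.sqrt (v₀ ^ 2 * p.1 ^ 2 + v₁ ^ 2 * p.2 ^ 2)) -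
            χ (γ * Real.sqrt (v₀ ^ 2 * p.1 ^ 2 + v₁ ^ 2 * p.2 ^ 2)) : ℝ) : ℂ) /
          (Complex.I * (v₀ : ℂ) * (p.1 : ℂ) + (v₁ : ℂ) * (p.2 : ℂ) + ((R p.2 : ℝ) : ℂ)) with hG
    have hfun : (fun p : ℝ × ℝ =>
        ((χ (c * Real.sqrt (v₀ ^ 2 * p.1 ^ 2 + v₁ ^ 2 * p.2 ^ 2)) -
            χ (γ ^ (-(h : ℝ) + 1) *
              Real.sqrt (v₀ ^ 2 * p.1 ^ 2 + v₁ ^ 2 * p.2 ^ 2)) : ℝ) : ℂ) /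
          (Complex.I * (v₀ : ℂ) * (p.1 : ℂ) + (v₁ : ℂ) * (p.2 : ℂ) +
            ((r p.2 : ℝ) : ℂ))) = fun p => (c : ℂ) * G (c * p.1, c * p.2) := by
      funext p
      simp only [hG]
      rw [hden, hsq, hc1, mul_assoc γ c, ← mul_div_assoc, mul_div_mul_left _ _ hcC]
    rw [hfun, aux_mixed_scale, norm_mul, norm_mul, norm_pow, Complex.norm_real,
      Real.norm_of_nonneg hc0.le]
    have hpow : γ ^ (-(h : ℝ) * (1 + (n₀ : ℝ) + (n₁ : ℝ))) = c * c ^ (n₀ + n₁) := by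
      rw [Real.rpow_mul hγ0.le, ← hc, ← pow_succ', ← Real.rpow_natCast]
      congr 1; push_cast; ring
    rw [hpow, mul_comm]
    gcongr

end
end
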